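/- Let Γ be an artin algebra of finite global dimension with dominant dimension at least 2, T_C the unique tilting module in C_Γ, and B_C = End_Γ(T_C)^op. Then gldim B_C < gldim Γ if and only if the projective dimension of the Auslander-Reiten translate τT_C is strictly less than gldim Γ. -/

import Mathlib

open Function LinearMap

section Prelim

variable (Λ : Type) [Ring Λ]

/-- A module that is both projective and injective. -/
def IsProjInj (M : Type) [AddCommGroup M] [Module Λ M] : Prop :=
  Module.Projective Λ M ∧ Module.Injective Λ M

/-- `X` is generated by the projective-injective modules: it is a quotient of a
finitely generated projective-injective module (equivalently, of a finite direct sum of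
copies of `Q̃`). -/
def GenByProjInj (X : Type) [AddCommGroup X] [Module Λ X] : Prop :=
  ∃ Q : ModuleCat.{0} Λ, Module.Finite Λ Q ∧ IsProjInj Λ Q ∧
    ∃ f : Q →ₗ[Λ] X, Surjective f

/-- `X` is cogenerated by the projective-injective modules: it embeds into a
finitely generated projective-injective module. -/
def CogenByProjInj (X : Type) [AddCommGroup X] [Module Λ X] : Prop :=
  ∃ Q : ModuleCat.{0} Λ, Module.Finite Λ Q ∧ IsProjInj Λ Q ∧
    ∃ f : X →ₗ[Λ] Q, Injective f

/-- Membership in `C_Λ = Gen(Q̃) ∩ Cogen(Q̃)`. -/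
def MemC (X : Type) [AddCommGroup X] [Module Λ X] : Prop :=
  GenByProjInj Λ X ∧ CogenByProjInj Λ X

/-- `pdLEcat Λ n X` : `X` has projective dimension at most `n`. -/
def pdLEcat : ℕ → ModuleCat.{0} Λ → Prop
  | 0, X => Module.Projective Λ X
  | n+1, X => ∃ (P : ModuleCat.{0} Λ) (g : P →ₗ[Λ] X),
      Module.Projective Λ P ∧ Module.Finite Λ P ∧ Surjective g ∧
      pdLEcat n (ModuleCat.of Λ (↥(LinearMap.ker g)))

/-- Projective dimension at most `n`, for a bare module. -/
def pdLE (n : ℕ) (X : Type) [AddCommGroup X] [Module Λ X] : Prop :=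
  pdLEcat Λ n (ModuleCat.of Λ X)

/-- `idLEcat Λ n X` : `X` has injective dimension at most `n`. -/
def idLEcat : ℕ → ModuleCat.{0} Λ → Prop
  | 0, X => Module.Injective Λ X
  | n+1, X => ∃ (I : ModuleCat.{0} Λ) (f : X →ₗ[Λ] I),
      Module.Injective Λ I ∧ Injective f ∧
      idLEcat n (ModuleCat.of Λ (↥I ⧸ LinearMap.range f))

/-- Injective dimension at most `n`, for a bare module. -/
def idLE (n : ℕ) (X : Type) [AddCommGroup X] [Module Λ X] : Prop :=
  idLEcat Λ n (ModuleCat.of Λ X)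

/-- Global dimension at most `d` (on finitely generated modules). -/
def GlobalDimLE (d : ℕ) : Prop :=
  ∀ X : ModuleCat.{0} Λ, Module.Finite Λ X → pdLEcat Λ d X

/-- Global dimension exactly `d`. -/
def GlobalDimEq (d : ℕ) : Prop :=
  GlobalDimLE Λ d ∧ ∀ m, GlobalDimLE Λ m → d ≤ m

/-- `Ext¹_Λ(Y, X) = 0`, expressed by the splitting of all short exact sequences
`0 → X → E → Y → 0`. -/
def Ext1Vanish (Y X : Type) [AddCommGroup Y] [Module Λ Y]
    [AddCommGroup X] [Module Λ X] : Prop :=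
  ∀ (E : ModuleCat.{0} Λ) (f : X →ₗ[Λ] E) (g : E →ₗ[Λ] Y),
    Injective f → Surjective g → LinearMap.range f = LinearMap.ker g →
    ∃ r : E →ₗ[Λ] X, r ∘ₗ f = LinearMap.id

/-- `M` belongs to `add T`: `M` is a direct summand of a finite direct sum of copies of `T`. -/
def InAddOf (T M : Type) [AddCommGroup T] [Module Λ T]
    [AddCommGroup M] [Module Λ M] : Prop :=
  ∃ (m : ℕ) (p : (Fin m → T) →ₗ[Λ] M) (s : M →ₗ[Λ] (Fin m → T)),
    p ∘ₗ s = LinearMap.id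

/-- A (classical) tilting module. -/
def IsTilting (T : Type) [AddCommGroup T] [Module Λ T] : Prop :=
  pdLE Λ 1 T ∧ Ext1Vanish Λ T T ∧
  ∃ (T0 T1 : ModuleCat.{0} Λ) (f : Λ →ₗ[Λ] T0) (g : T0 →ₗ[Λ] T1),
    InAddOf Λ T T0 ∧ InAddOf Λ T T1 ∧ Injective f ∧ Surjective g ∧
    LinearMap.range f = LinearMap.ker g

/-- A (classical) cotilting module. -/
def IsCotilting (T : Type) [AddCommGroup T] [Module Λ T] : Prop :=
  idLE Λ 1 T ∧ Ext1Vanish Λ T T ∧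
  ∀ (I : ModuleCat.{0} Λ), Module.Finite Λ I → Module.Injective Λ I →
    ∃ (C0 C1 : ModuleCat.{0} Λ) (u : C0 →ₗ[Λ] C1) (v : C1 →ₗ[Λ] I),
      InAddOf Λ T C0 ∧ InAddOf Λ T C1 ∧ Injective u ∧ Surjective v ∧
      LinearMap.range u = LinearMap.ker v

/-- Dominant dimension at least `2`: there is an exact sequence `0 → Λ → Q₀ → Q₁`
with `Q₀, Q₁` projective-injective. -/
def DomdimGE2 : Prop :=
  ∃ (Q0 Q1 : ModuleCat.{0} Λ) (f : Λ →ₗ[Λ] Q0) (g : Q0 →ₗ[Λ] Q1),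
    Module.Finite Λ Q0 ∧ IsProjInj Λ Q0 ∧ Module.Finite Λ Q1 ∧ IsProjInj Λ Q1 ∧
    Injective f ∧ LinearMap.range f = LinearMap.ker g

/-- An indecomposable (nonzero) module: the only idempotent endomorphisms are `0` and `id`. -/
def Indecomposable (M : Type) [AddCommGroup M] [Module Λ M] : Prop :=
  (∃ x : M, x ≠ 0) ∧ ∀ e : M →ₗ[Λ] M, e ∘ₗ e = e → e = 0 ∨ e = LinearMap.id

/-- A right minimal morphism. -/
def RightMinimal {B C : Type} [AddCommGroup B] [Module Λ B] [AddCommGroup C] [Module Λ C]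
    (f : B →ₗ[Λ] C) : Prop :=
  ∀ g : B →ₗ[Λ] B, f ∘ₗ g = f → Bijective g

/-- A left minimal morphism. -/
def LeftMinimal {A B : Type} [AddCommGroup A] [Module Λ A] [AddCommGroup B] [Module Λ B]
    (f : A →ₗ[Λ] B) : Prop :=
  ∀ g : B →ₗ[Λ] B, g ∘ₗ f = f → Bijective g

/-- `f : P → X` is a projective cover: `P` is projective, `f` is surjective and its kernel
is superfluous. -/
def IsProjCover {P X : Type} [AddCommGroup P] [Module Λ P] [AddCommGroup X] [Module Λ X]
    (f : P →ₗ[Λ] X) : Prop :=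
  Module.Projective Λ P ∧ Surjective f ∧
    ∀ N : Submodule Λ P, N ⊔ LinearMap.ker f = ⊤ → N = ⊤

/-- `f : X → I` is an injective envelope: `I` is injective, `f` is injective and its image is
essential. -/
def IsInjEnv {X I : Type} [AddCommGroup X] [Module Λ X] [AddCommGroup I] [Module Λ I]
    (f : X →ₗ[Λ] I) : Prop :=
  Module.Injective Λ I ∧ Injective f ∧
    ∀ N : Submodule Λ I, N ⊓ LinearMap.range f = ⊥ → N = ⊥

/-- An essential submodule. -/
def IsEssentialSub {M : Type} [AddCommGroup M] [Module Λ M] (N : Submodule Λ M) : Prop :=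
  ∀ N' : Submodule Λ M, N ⊓ N' = ⊥ → N' = ⊥

/-- A uniserial module: submodules are totally ordered by inclusion. -/
def Uniserial (M : Type) [AddCommGroup M] [Module Λ M] : Prop :=
  ∀ N₁ N₂ : Submodule Λ M, N₁ ≤ N₂ ∨ N₂ ≤ N₁

/-- The radical of a module: the intersection of its maximal submodules. -/
def radSub (M : Type) [AddCommGroup M] [Module Λ M] : Submodule Λ M :=
  sInf {N : Submodule Λ M | IsCoatom N}

/-- An almost split (Auslander-Reiten) sequence `0 → A → E → C → 0`. -/
def IsAlmostSplitSeq {A E C : Type} [AddCommGroup A] [Module Λ A]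
    [AddCommGroup E] [Module Λ E] [AddCommGroup C] [Module Λ C]
    (f : A →ₗ[Λ] E) (g : E →ₗ[Λ] C) : Prop :=
  Injective f ∧ Surjective g ∧ LinearMap.range f = LinearMap.ker g ∧
  (¬∃ r : E →ₗ[Λ] A, r ∘ₗ f = LinearMap.id) ∧
  Indecomposable Λ A ∧ Indecomposable Λ C ∧
  ∀ (Z : ModuleCat.{0} Λ) (h : Z →ₗ[Λ] C), Module.Finite Λ Z →
    (¬∃ s : C →ₗ[Λ] Z, h ∘ₗ s = LinearMap.id) → ∃ l : (Z →ₗ[Λ] E), g ∘ₗ l = h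

/-- `N` is the Auslander-Reiten translate `τ M` of `M`: writing `M ≅ P ⊕ (⊕ᵢ Cᵢ)` with `P`
projective and `Cᵢ` indecomposable ends of almost split sequences `0 → Aᵢ → Eᵢ → Cᵢ → 0`,
we have `N ≅ ⊕ᵢ Aᵢ`. -/
def IsTauOf (N M : Type) [AddCommGroup N] [Module Λ N] [AddCommGroup M] [Module Λ M] : Prop :=
  ∃ (r : ℕ) (P : ModuleCat.{0} Λ) (A E C : Fin r → ModuleCat.{0} Λ)
    (f : ∀ i, (A i : Type) →ₗ[Λ] (E i : Type)) (g : ∀ i, (E i : Type) →ₗ[Λ] (C i : Type)),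
    Module.Projective Λ P ∧ (∀ i, IsAlmostSplitSeq Λ (f i) (g i)) ∧
    Nonempty (M ≃ₗ[Λ] (Prod (P : Type) ((i : Fin r) → (C i : Type)))) ∧
    Nonempty (N ≃ₗ[Λ] (∀ i, (A i : Type)))

end Prelim

section HomModule

variable {R : Type} [Ring R] {T M : Type} [AddCommGroup T] [Module R T]
  [AddCommGroup M] [Module R M]

/-- `Hom_R(T, M)` as a left module over `B = End_R(T)ᵒᵖ`, via precomposition. -/
instance instSMulHomEndOp : SMul (Module.End R T)ᵐᵒᵖ (T →ₗ[R] M) :=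
  ⟨fun b f => f ∘ₗ b.unop⟩

lemma endOp_smul_def (b : (Module.End R T)ᵐᵒᵖ) (f : T →ₗ[R] M) :
    b • f = f ∘ₗ b.unop := rfl

instance instMulActionHomEndOp : MulAction (Module.End R T)ᵐᵒᵖ (T →ₗ[R] M) where
  one_smul f := by ext x; rfl
  mul_smul b c f := by ext x; rfl

instance instDistribMulActionHomEndOp :
    DistribMulAction (Module.End R T)ᵐᵒᵖ (T →ₗ[R] M) where
  smul_zero b := by ext x; rfl
  smul_add b f g := by ext x; rfl

instance instModuleHomEndOp : Module (Module.End R T)ᵐᵒᵖ (T →ₗ[R] M) where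
  add_smul b c f := by ext x; simp [endOp_smul_def]
  zero_smul f := by ext x; simp [endOp_smul_def]

end HomModule

section ExtPart
open CategoryTheory CategoryTheory.Abelian

variable {Λ : Type} [Ring Λ]

/-- Vanishing of `Ext^n(X, Y)`. -/
def EV (Λ : Type) [Ring Λ] (n : ℕ) (X Y : Type) [AddCommGroup X] [Module Λ X]
    [AddCommGroup Y] [Module Λ Y] : Prop :=
  letI := HasExt.standard (ModuleCat.{0} Λ)
  ∀ e : Ext (ModuleCat.of Λ X) (ModuleCat.of Λ Y) n, e = 0

/-- Projective dimension `< n` -/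
abbrev PD (Λ : Type) [Ring Λ] (n : ℕ) (X : Type) [AddCommGroup X] [Module Λ X] : Prop :=
  HasProjectiveDimensionLT (ModuleCat.of Λ X) n

variable {A B C X Y : Type} [AddCommGroup A] [Module Λ A] [AddCommGroup B] [Module Λ B]
  [AddCommGroup C] [Module Λ C] [AddCommGroup X] [Module Λ X] [AddCommGroup Y] [Module Λ Y]

lemma PD.ev {n : ℕ} (h : PD Λ n X) {i : ℕ} (hi : n ≤ i) : EV Λ i X Y := by
  let := HasExt.standard (ModuleCat.{0} Λ)
  intro e
  exact e.eq_zero_of_hasProjectiveDimensionLT n hi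

lemma PD.of_ev {n : ℕ} (h : ∀ (Y : Type) [AddCommGroup Y] [Module Λ Y], EV Λ n X Y) :
    PD Λ n X := by
  let := HasExt.standard (ModuleCat.{0} Λ)
  apply hasProjectiveDimensionLT_of_enoughInjectives
  intro Y
  exact ⟨fun a b => (h Y a).trans (h Y b).symm⟩

lemma PD.mono {n m : ℕ} (h : PD Λ n X) (hi : n ≤ m) : PD Λ m X :=
  hasProjectiveDimensionLT_of_ge _ n m hi

lemma mkSE (f : A →ₗ[Λ] B) (g : B →ₗ[Λ] C) (hf : Injective f) (hg : Surjective g)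
    (hfg : LinearMap.range f = LinearMap.ker g) :
    (ShortComplex.mk (ModuleCat.ofHom f) (ModuleCat.ofHom g) (by
      ext x
      have : f x ∈ LinearMap.ker g := hfg ▸ ⟨x, rfl⟩
      simpa using this)).ShortExact where
  exact := by
    rw [ShortComplex.moduleCat_exact_iff_range_eq_ker]
    exact hfg
  mono_f := (ModuleCat.mono_iff_injective _).2 hf
  epi_g := (ModuleCat.epi_iff_surjective _).2 hg

lemma ev_mid (f : A →ₗ[Λ] B) (g : B →ₗ[Λ] C) (hf : Injective f) (hg : Surjective g)
    (hfg : LinearMap.range f = LinearMap.ker g)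
    {n : ℕ} (h1 : EV Λ n A Y) (h3 : EV Λ n C Y) : EV Λ n B Y := by
  let := HasExt.standard (ModuleCat.{0} Λ)
  intro e
  obtain ⟨x₃, rfl⟩ := Ext.contravariant_sequence_exact₂ (mkSE f g hf hg hfg) _ e (h1 _)
  rw [h3 x₃, Ext.comp_zero]

lemma ev_left (f : A →ₗ[Λ] B) (g : B →ₗ[Λ] C) (hf : Injective f) (hg : Surjective g)
    (hfg : LinearMap.range f = LinearMap.ker g)
    {n : ℕ} (h2 : EV Λ n B Y) (h3 : EV Λ (n + 1) C Y) : EV Λ n A Y := by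
  let := HasExt.standard (ModuleCat.{0} Λ)
  intro e
  obtain ⟨x₃, rfl⟩ := Ext.contravariant_sequence_exact₁ (mkSE f g hf hg hfg) _ e (add_comm _ _)
    (h3 _)
  rw [h2 x₃, Ext.comp_zero]

lemma ev_right (f : A →ₗ[Λ] B) (g : B →ₗ[Λ] C) (hf : Injective f) (hg : Surjective g)
    (hfg : LinearMap.range f = LinearMap.ker g)
    {n : ℕ} (h1 : EV Λ n A Y) (h2 : EV Λ (n + 1) B Y) : EV Λ (n + 1) C Y := by
  let := HasExt.standard (ModuleCat.{0} Λ)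
  intro e
  obtain ⟨x₃, rfl⟩ := Ext.contravariant_sequence_exact₃ (mkSE f g hf hg hfg) _ e (h2 _)
    (add_comm _ _)
  rw [h1 x₃, Ext.comp_zero]

lemma evc_mid (f : A →ₗ[Λ] B) (g : B →ₗ[Λ] C) (hf : Injective f) (hg : Surjective g)
    (hfg : LinearMap.range f = LinearMap.ker g)
    {n : ℕ} (h1 : EV Λ n X A) (h3 : EV Λ n X C) : EV Λ n X B := by
  let := HasExt.standard (ModuleCat.{0} Λ)
  intro e
  obtain ⟨x₃, rfl⟩ := Ext.covariant_sequence_exact₂ _ (mkSE f g hf hg hfg) e (h3 _)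
  rw [h1 x₃, Ext.zero_comp]

lemma evc_right (f : A →ₗ[Λ] B) (g : B →ₗ[Λ] C) (hf : Injective f) (hg : Surjective g)
    (hfg : LinearMap.range f = LinearMap.ker g)
    {n : ℕ} (h2 : EV Λ n X B) (h1 : EV Λ (n + 1) X A) : EV Λ n X C := by
  let := HasExt.standard (ModuleCat.{0} Λ)
  intro e
  obtain ⟨x₃, rfl⟩ := Ext.covariant_sequence_exact₃ _ (mkSE f g hf hg hfg) e rfl (h1 _)
  rw [h2 x₃, Ext.zero_comp]

lemma ev_lift (f : A →ₗ[Λ] B) (g : B →ₗ[Λ] C) (hf : Injective f) (hg : Surjective g)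
    (hfg : LinearMap.range f = LinearMap.ker g)
    (h1 : EV Λ 1 X A) (h : X →ₗ[Λ] C) : ∃ l : X →ₗ[Λ] B, g ∘ₗ l = h := by
  let := HasExt.standard (ModuleCat.{0} Λ)
  obtain ⟨x, hx⟩ := Ext.covariant_sequence_exact₃ _ (mkSE f g hf hg hfg)
    (Ext.mk₀ (ModuleCat.ofHom h)) (zero_add 1) (h1 _)
  obtain ⟨φ, rfl⟩ := Ext.homEquiv₀.symm.surjective x
  refine ⟨φ.hom, ?_⟩
  have : φ ≫ ModuleCat.ofHom g = ModuleCat.ofHom h := Ext.homEquiv₀.symm.injective (by simpa using hx)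
  have := congrArg ModuleCat.Hom.hom this
  simpa using this

lemma ev_of_lift (f : A →ₗ[Λ] B) (g : B →ₗ[Λ] C) (hf : Injective f) (hg : Surjective g)
    (hfg : LinearMap.range f = LinearMap.ker g)
    (h2 : EV Λ 1 X B) (hl : ∀ h : X →ₗ[Λ] C, ∃ l : X →ₗ[Λ] B, g ∘ₗ l = h) :
    EV Λ 1 X A := by
  let := HasExt.standard (ModuleCat.{0} Λ)
  intro e
  obtain ⟨x, hx⟩ := Ext.covariant_sequence_exact₁ _ (mkSE f g hf hg hfg) e (h2 _) (zero_add 1)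
  obtain ⟨φ, rfl⟩ := Ext.homEquiv₀.symm.surjective x
  obtain ⟨l, hl⟩ := hl φ.hom
  have h3 : φ = ModuleCat.ofHom l ≫ ModuleCat.ofHom g := by
    apply ModuleCat.hom_ext
    exact hl.symm
  rw [← hx, Ext.homEquiv₀_symm_apply, h3, ← Ext.mk₀_comp_mk₀]
  rw [Ext.comp_assoc_of_second_deg_zero]
  erw [(mkSE f g hf hg hfg).comp_extClass]
  simp

lemma pd_mid (f : A →ₗ[Λ] B) (g : B →ₗ[Λ] C) (hf : Injective f) (hg : Surjective g)
    (hfg : LinearMap.range f = LinearMap.ker g)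
    {n : ℕ} (h1 : PD Λ n A) (h3 : PD Λ n C) : PD Λ n B :=
  (mkSE f g hf hg hfg).hasProjectiveDimensionLT_X₂ n h1 h3

lemma pd_right (f : A →ₗ[Λ] B) (g : B →ₗ[Λ] C) (hf : Injective f) (hg : Surjective g)
    (hfg : LinearMap.range f = LinearMap.ker g)
    {n : ℕ} (h1 : PD Λ n A) (h3 : PD Λ (n+1) B) : PD Λ (n+1) C :=
  (mkSE f g hf hg hfg).hasProjectiveDimensionLT_X₃ n h1 h3

lemma pd_left (f : A →ₗ[Λ] B) (g : B →ₗ[Λ] C) (hf : Injective f) (hg : Surjective g)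
    (hfg : LinearMap.range f = LinearMap.ker g)
    {n : ℕ} (h1 : PD Λ n B) (h3 : PD Λ (n+1) C) : PD Λ n A :=
  (mkSE f g hf hg hfg).hasProjectiveDimensionLT_X₁ n h1 h3

lemma ev_ext (f : A →ₗ[Λ] B) (g : B →ₗ[Λ] C) (hf : Injective f) (hg : Surjective g)
    (hfg : LinearMap.range f = LinearMap.ker g)
    (h1 : EV Λ 1 C Y) (h : A →ₗ[Λ] Y) : ∃ l : B →ₗ[Λ] Y, l ∘ₗ f = h := by
  let := HasExt.standard (ModuleCat.{0} Λ)
  obtain ⟨x, hx⟩ := Ext.contravariant_sequence_exact₁ (mkSE f g hf hg hfg) _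
    (Ext.mk₀ (ModuleCat.ofHom h)) (add_zero 1) (h1 _)
  obtain ⟨φ, rfl⟩ := Ext.homEquiv₀.symm.surjective x
  refine ⟨φ.hom, ?_⟩
  have : ModuleCat.ofHom f ≫ φ = ModuleCat.ofHom h :=
    Ext.homEquiv₀.symm.injective (by simpa using hx)
  have := congrArg ModuleCat.Hom.hom this
  simpa using this

lemma ev_of_ext (f : A →ₗ[Λ] B) (g : B →ₗ[Λ] C) (hf : Injective f) (hg : Surjective g)
    (hfg : LinearMap.range f = LinearMap.ker g)
    (h2 : EV Λ 1 B Y) (hl : ∀ h : A →ₗ[Λ] Y, ∃ l : B →ₗ[Λ] Y, l ∘ₗ f = h) :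
    EV Λ 1 C Y := by
  let := HasExt.standard (ModuleCat.{0} Λ)
  intro e
  obtain ⟨x, hx⟩ := Ext.contravariant_sequence_exact₃ (mkSE f g hf hg hfg) _ e (h2 _) (add_zero 1)
  obtain ⟨φ, rfl⟩ := Ext.homEquiv₀.symm.surjective x
  obtain ⟨l, hl⟩ := hl φ.hom
  have h3 : φ = ModuleCat.ofHom f ≫ ModuleCat.ofHom l := by
    apply ModuleCat.hom_ext
    exact hl.symm
  rw [← hx, Ext.homEquiv₀_symm_apply, h3, ← Ext.mk₀_comp_mk₀]
  rw [← Ext.comp_assoc_of_second_deg_zero]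
  erw [(mkSE f g hf hg hfg).extClass_comp]
  simp

lemma ev_inj {n : ℕ} (h : Module.Injective Λ Y) : EV Λ (n+1) X Y := by
  let := HasExt.standard (ModuleCat.{0} Λ)
  intro e
  have := Module.injective_object_of_injective_module Λ Y
  exact e.eq_zero_of_injective

lemma pd_one_iff : PD Λ 1 X ↔ Module.Projective Λ X := by
  rw [IsProjective.iff_projective, projective_iff_hasProjectiveDimensionLT_one]

lemma ev_retract {n : ℕ} (s : X →ₗ[Λ] B) (p : B →ₗ[Λ] X) (h : p ∘ₗ s = LinearMap.id)
    (hB : EV Λ n B Y) : EV Λ n X Y := by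
  let := HasExt.standard (ModuleCat.{0} Λ)
  intro x
  have : ModuleCat.ofHom s ≫ ModuleCat.ofHom p = 𝟙 (ModuleCat.of Λ X) := by
    rw [← ModuleCat.ofHom_comp, h]; rfl
  rw [← x.mk₀_id_comp, ← this, ← Ext.mk₀_comp_mk₀,
    Ext.comp_assoc_of_second_deg_zero, hB ((Ext.mk₀ (ModuleCat.ofHom p)).comp x (zero_add n)),
    Ext.comp_zero]

lemma pd_retract {n : ℕ} (s : X →ₗ[Λ] B) (p : B →ₗ[Λ] X) (h : p ∘ₗ s = LinearMap.id)
    (hB : PD Λ n B) : PD Λ n X :=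
  PD.of_ev fun _ _ _ => ev_retract s p h (hB.ev le_rfl)

lemma pd_equiv {n : ℕ} (e : X ≃ₗ[Λ] B) (hB : PD Λ n B) : PD Λ n X :=
  pd_retract e.toLinearMap e.symm.toLinearMap (by ext; simp) hB

/-- products in the first variable -/
lemma ev_pi_aux {n : ℕ} : ∀ (r : ℕ) (D : Fin r → ModuleCat.{0} Λ)
    (_ : ∀ i, EV Λ n (D i) Y), EV Λ n (∀ i, (D i : Type)) Y := by
  intro r
  induction r with
  | zero =>
    intro D h
    let := HasExt.standard (ModuleCat.{0} Λ)
    intro x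
    have : 𝟙 (ModuleCat.of Λ (∀ i : Fin 0, (D i : Type))) = 0 := by
      apply ModuleCat.hom_ext
      apply LinearMap.ext
      intro x
      funext i
      exact i.elim0
    rw [← x.mk₀_id_comp, this, Ext.mk₀_zero, Ext.zero_comp]
  | succ r ih =>
    intro D h
    refine ev_mid (LinearMap.single Λ (fun i => (D i : Type)) 0)
      (LinearMap.pi (fun i : Fin r => LinearMap.proj i.succ) :
        (∀ i, (D i : Type)) →ₗ[Λ] (∀ i : Fin r, (D i.succ : Type))) ?_ ?_ ?_ (h 0)
        (ih (fun i => D i.succ) fun i => h i.succ)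
    · exact Pi.single_injective (M := fun i => (D i : Type)) 0
    · intro y
      exact ⟨Fin.cons 0 y, by ext i; simp⟩
    · ext x
      constructor
      · rintro ⟨a, rfl⟩
        rw [LinearMap.mem_ker]
        ext i
        simp
      · intro hx
        refine ⟨x 0, ?_⟩
        ext i
        refine Fin.cases ?_ (fun i => ?_) i
        · simp
        · have := congrFun (LinearMap.mem_ker.1 hx) i
          simpa using this.symm

lemma ev_pow {n : ℕ} (r : ℕ) (h : EV Λ n X Y) : EV Λ n (Fin r → X) Y :=
  ev_pi_aux r (fun _ => ModuleCat.of Λ X) fun _ => h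

lemma pd_pow {n : ℕ} (r : ℕ) (h : PD Λ n X) : PD Λ n (Fin r → X) :=
  PD.of_ev fun _ _ _ => ev_pow r (h.ev le_rfl)

lemma pd_of_pdLEcat : ∀ (n : ℕ) (X : ModuleCat.{0} Λ), pdLEcat Λ n X → PD Λ (n+1) X
  | 0, _, h => pd_one_iff.2 h
  | n+1, X, ⟨P, g, hP, _, hg, h⟩ => by
    have := pd_of_pdLEcat n _ h
    exact pd_right (LinearMap.ker g).subtype g (Submodule.subtype_injective _) hg (by simp) this
      ((pd_one_iff.2 hP).mono (by omega))

lemma pd_of_pdLE {n : ℕ} (h : pdLE Λ n X) : PD Λ (n+1) X := pd_of_pdLEcat n _ h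

lemma pdLEcat_of_pd [IsNoetherianRing Λ] : ∀ (n : ℕ) (X : ModuleCat.{0} Λ), Module.Finite Λ X →
    PD Λ (n+1) X → pdLEcat Λ n X
  | 0, _, _, h => pd_one_iff.1 h
  | n+1, X, hX, h => by
    obtain ⟨m, g, hg⟩ := Module.Finite.exists_fin' Λ X
    refine ⟨ModuleCat.of Λ (Fin m → Λ), g, inferInstanceAs (Module.Projective Λ (Fin m → Λ)),
      inferInstanceAs (Module.Finite Λ (Fin m → Λ)), hg, ?_⟩
    refine pdLEcat_of_pd n _ (inferInstanceAs (Module.Finite Λ (LinearMap.ker g))) ?_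
    refine pd_left (LinearMap.ker g).subtype g (Submodule.subtype_injective _) hg (by simp) ?_ h
    exact (pd_one_iff.2 inferInstance).mono (by omega)

lemma ev_of_ext1Vanish (h : Ext1Vanish Λ Y X) : EV Λ 1 Y X := by
  obtain ⟨⟨I, hI, f, hf⟩⟩ := (inferInstance : EnoughInjectives (ModuleCat.{0} Λ)).presentation
    (ModuleCat.of Λ X)
  have hI' : Module.Injective Λ I := Module.injective_module_of_injective_object Λ I
  have hf' := (ModuleCat.mono_iff_injective _).1 hf
  refine ev_of_lift (B := I) f.hom (LinearMap.range f.hom).mkQ hf' (Submodule.mkQ_surjective _)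
    (by simp) (ev_inj hI') ?_
  intro h'
  let E : Submodule Λ (I × Y) := LinearMap.ker
    ((LinearMap.range f.hom).mkQ ∘ₗ LinearMap.fst Λ I Y - h' ∘ₗ LinearMap.snd Λ I Y)
  have hE : ∀ z : I × Y, z ∈ E ↔ (LinearMap.range f.hom).mkQ z.1 = h' z.2 := by
    intro z; simp only [E, LinearMap.mem_ker, LinearMap.sub_apply, sub_eq_zero]; rfl
  let i : X →ₗ[Λ] E := LinearMap.codRestrict E (LinearMap.inl Λ I Y ∘ₗ f.hom) (by
    intro c; rw [hE]; simp)
  let q : E →ₗ[Λ] Y := LinearMap.snd Λ I Y ∘ₗ E.subtype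
  obtain ⟨r', hr⟩ := h (ModuleCat.of Λ E) i q (by
      intro a b hab
      have := congrArg (fun z : E => z.1.1) hab
      exact hf' this) (by
      intro y
      obtain ⟨a, ha⟩ := Submodule.mkQ_surjective _ (h' y)
      exact ⟨⟨(a, y), (hE _).2 ha⟩, rfl⟩) (by
      ext z
      constructor
      · rintro ⟨a, rfl⟩; rfl
      · intro hz
        have hz' : z.1.2 = 0 := hz
        have h1 := (hE z.1).1 z.2
        rw [hz', map_zero] at h1
        have h2 : z.1.1 ∈ LinearMap.range f.hom := by simpa using h1
        obtain ⟨a, ha⟩ := h2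
        refine ⟨a, ?_⟩
        apply Subtype.ext
        exact Prod.ext ha hz'.symm)
  -- the retraction gives a section of `q`
  let r : E →ₗ[Λ] X := r'
  have hr : ∀ a, r (i a) = a := fun a => LinearMap.congr_fun hr a
  have hex : ∀ y : Y, ∃ z : E, r z = 0 ∧ q z = y := by
    intro y
    obtain ⟨a, ha⟩ := Submodule.mkQ_surjective _ (h' y)
    let z : E := ⟨(a, y), (hE _).2 ha⟩
    refine ⟨z - i (r z), ?_, ?_⟩
    · rw [map_sub]
      rw [hr, sub_self]
    · rw [map_sub]
      have : q (i (r z)) = 0 := rfl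
      rw [this, sub_zero]
      rfl
  have huniq : ∀ z : E, r z = 0 → q z = 0 → z = 0 := by
    intro z hz hq
    have hz' : z.1.2 = 0 := hq
    have h1 := (hE z.1).1 z.2
    rw [hz', map_zero] at h1
    have h2 : z.1.1 ∈ LinearMap.range f.hom := by simpa using h1
    obtain ⟨a, ha⟩ := h2
    have h3 : i a = z := Subtype.ext (Prod.ext ha hz'.symm)
    have h4 := hr a
    rw [h3, hz] at h4
    rw [← h3, ← h4, map_zero]
  let K : Submodule Λ E := LinearMap.ker r
  let e : K ≃ₗ[Λ] Y := LinearEquiv.ofBijective (q ∘ₗ K.subtype) ⟨by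
    refine (injective_iff_map_eq_zero _).2 ?_
    intro z hz
    exact Subtype.ext (huniq z.1 z.2 hz), fun y => by
    obtain ⟨z, h1, h2⟩ := hex y
    exact ⟨⟨z, h1⟩, h2⟩⟩
  refine ⟨LinearMap.fst Λ I Y ∘ₗ E.subtype ∘ₗ K.subtype ∘ₗ e.symm.toLinearMap, ?_⟩
  ext y
  have h1 := (hE (e.symm y).1.1).1 (e.symm y).1.2
  have h2 : (e.symm y).1.1.2 = y := e.apply_symm_apply y
  rw [h2] at h1
  exact h1

end ExtPart

section KPart

variable {Λ : Type} [Ring Λ] {k : Type} [CommRing k] [Algebra k Λ]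

/-- multiplication by a scalar of the ground ring -/
def scal (Λ : Type) [Ring Λ] {k : Type} [CommRing k] [Algebra k Λ] (c : k) (X : Type)
    [AddCommGroup X] [Module Λ X] : X →ₗ[Λ] X where
  toFun x := algebraMap k Λ c • x
  map_add' x y := smul_add _ x y
  map_smul' a x := by
    simp only [RingHom.id_apply, ← mul_smul, Algebra.commutes]

lemma scal_comp {X Y : Type} [AddCommGroup X] [Module Λ X] [AddCommGroup Y] [Module Λ Y]
    (c : k) (f : X →ₗ[Λ] Y) : f ∘ₗ scal Λ c X = scal Λ c Y ∘ₗ f := by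
  ext x
  exact f.map_smul _ _

variable [IsArtinianRing k] [Module.Finite k Λ]

lemma homgen (k : Type) [CommRing k] [Algebra k Λ] [IsArtinianRing k] [Module.Finite k Λ]
    (X Y : Type) [AddCommGroup X] [Module Λ X] [AddCommGroup Y] [Module Λ Y]
    [Module.Finite Λ X] [Module.Finite Λ Y] :
    ∃ (n : ℕ) (φ : Fin n → X →ₗ[Λ] Y), ∀ ψ : X →ₗ[Λ] Y, ∃ c : Fin n → k,
      ψ = ∑ i, φ i ∘ₗ scal Λ (c i) X := by
  let : Module k Y := Module.compHom Y (algebraMap k Λ)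
  have hs : ∀ (c : k) (y : Y), c • y = algebraMap k Λ c • y := fun _ _ => rfl
  have : IsScalarTower k Λ Y := ⟨fun a b y => by
    rw [hs, ← mul_smul, Algebra.smul_def]⟩
  have : SMulCommClass Λ k Y := ⟨fun a b y => by
    rw [hs, hs, ← mul_smul, ← mul_smul, Algebra.commutes]⟩
  have : Module.Finite k Y := Module.Finite.trans Λ Y
  obtain ⟨m, g, hg⟩ := Module.Finite.exists_fin' Λ X
  let ev : (X →ₗ[Λ] Y) →ₗ[k] (Fin m → Y) :=
    { toFun := fun f i => f (g (Pi.single i 1))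
      map_add' := fun f f' => rfl
      map_smul' := fun c f => rfl }
  have hev : Injective ev := by
    intro f f' hff
    have : f ∘ₗ g = f' ∘ₗ g := by
      apply LinearMap.pi_ext'
      intro i
      ext
      exact congrFun hff i
    ext x
    obtain ⟨y, rfl⟩ := hg x
    exact LinearMap.congr_fun this y
  have : IsNoetherian k (X →ₗ[Λ] Y) := isNoetherian_of_injective ev hev
  obtain ⟨n, p, hp⟩ := Module.Finite.exists_fin' k (X →ₗ[Λ] Y)
  refine ⟨n, fun i => p (Pi.single i 1), fun ψ => ?_⟩
  obtain ⟨c, rfl⟩ := hp ψ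
  refine ⟨c, ?_⟩
  conv_lhs => rw [← Finset.univ_sum_single c]
  rw [map_sum]
  refine Finset.sum_congr rfl fun i _ => ?_
  have : (Pi.single i (c i) : Fin n → k) = c i • Pi.single i 1 := by
    rw [← Pi.single_smul]; simp
  rw [this, map_smul, scal_comp]
  rfl

lemma endNoeth (k : Type) [CommRing k] [Algebra k Λ] [IsArtinianRing k] [Module.Finite k Λ]
    (T : Type) [AddCommGroup T] [Module Λ T] [Module.Finite Λ T] :
    IsNoetherianRing (Module.End Λ T)ᵐᵒᵖ := by
  obtain ⟨n, φ, hφ⟩ := homgen (Λ := Λ) k T T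
  let ρ : k →+* (Module.End Λ T)ᵐᵒᵖ :=
    { toFun := fun c => MulOpposite.op (scal Λ c T)
      map_one' := by
        apply MulOpposite.unop_injective; ext x; simp [scal]
      map_zero' := by
        apply MulOpposite.unop_injective; ext x; simp [scal]
      map_mul' := fun a b => by
        apply MulOpposite.unop_injective; ext x
        change algebraMap k Λ (a * b) • x = algebraMap k Λ b • algebraMap k Λ a • x
        rw [← mul_smul, ← map_mul, mul_comm]
      map_add' := fun a b => by
        apply MulOpposite.unop_injective; ext x; simp [scal, add_smul] }
  let : Module k (Module.End Λ T)ᵐᵒᵖ := Module.compHom _ ρ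
  have : IsScalarTower k (Module.End Λ T)ᵐᵒᵖ (Module.End Λ T)ᵐᵒᵖ := ⟨fun a b c => by
    change (ρ a * b) * c = ρ a * (b * c)
    rw [mul_assoc]⟩
  have : Module.Finite k (Module.End Λ T)ᵐᵒᵖ := by
    refine ⟨Submodule.fg_def.2 ⟨Set.range fun i => MulOpposite.op (φ i), Set.finite_range _, ?_⟩⟩
    rw [eq_top_iff]
    rintro ψ -
    obtain ⟨c, hc⟩ := hφ ψ.unop
    have : ψ = ∑ i, c i • MulOpposite.op (φ i) := by
      have h1 : ψ = MulOpposite.opAddEquiv (∑ i, φ i ∘ₗ scal Λ (c i) T) := by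
        rw [← hc]; rfl
      rw [h1, map_sum]
      rfl
    rw [this]
    refine Submodule.sum_mem _ fun i _ => Submodule.smul_mem _ _ (Submodule.subset_span ?_)
    simp
  have : IsNoetherian k (Module.End Λ T)ᵐᵒᵖ := inferInstance
  exact isNoetherian_of_tower k this

end KPart

section BPart

variable {Λ : Type} [Ring Λ]

lemma inj_pow (m : ℕ) {Q : Type} [AddCommGroup Q] [Module Λ Q] (h : Module.Injective Λ Q) :
    Module.Injective Λ (Fin m → Q) := by
  constructor
  intro X Y _ _ _ _ f hf g
  choose l hl using fun i : Fin m => h.out f hf (LinearMap.proj i ∘ₗ g)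
  refine ⟨LinearMap.pi l, fun x => ?_⟩
  funext i
  exact hl i x

/-- The facts about `T` and the projective-injective `Q` that are used. -/
structure Setup (Λ : Type) [Ring Λ] (k : Type) [CommRing k] [IsArtinianRing k] [Algebra k Λ]
    [Module.Finite k Λ] (T Q : Type) [AddCommGroup T] [Module Λ T]
    [AddCommGroup Q] [Module Λ Q] : Prop where
  noeth : IsNoetherianRing Λ
  art : IsArtinianRing Λ
  finT : Module.Finite Λ T
  finQ : Module.Finite Λ Q
  projQ : Module.Projective Λ Q
  injQ : Module.Injective Λ Q
  pdT : PD Λ 2 T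
  gen : ∀ (X : Type) [AddCommGroup X] [Module Λ X], Module.Finite Λ X → EV Λ 1 T X →
    ∀ x : X, ∃ (m : ℕ) (p : (Fin m → T) →ₗ[Λ] X), x ∈ LinearMap.range p
  quot : ∃ q : Q →ₗ[Λ] T, Surjective q

variable {k : Type} [CommRing k] [IsArtinianRing k] [Algebra k Λ]
    [Module.Finite k Λ] {T Q : Type} [AddCommGroup T] [Module Λ T]
    [AddCommGroup Q] [Module Λ Q] {X Y M F : Type} [AddCommGroup X] [Module Λ X]
    [AddCommGroup Y] [Module Λ Y] [AddCommGroup M] [Module Λ M] [AddCommGroup F] [Module Λ F]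

lemma Setup.ev_quot (S : Setup Λ k T Q) (p : X →ₗ[Λ] Y) (hp : Surjective p) (h : EV Λ 1 T X) :
    EV Λ 1 T Y :=
  evc_right (LinearMap.ker p).subtype p (Submodule.subtype_injective _) hp (by simp) h
    (S.pdT.ev le_rfl)

lemma Setup.ev_quotQ (S : Setup Λ k T Q) (m : ℕ) (p : (Fin m → Q) →ₗ[Λ] Y) (hp : Surjective p) :
    EV Λ 1 T Y :=
  S.ev_quot p hp (ev_inj (inj_pow m S.injQ))

lemma Setup.ev_pow (S : Setup Λ k T Q) (m : ℕ) : EV Λ 1 T (Fin m → T) := by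
  obtain ⟨q, hq⟩ := S.quot
  refine S.ev_quotQ m (LinearMap.pi fun i => q ∘ₗ LinearMap.proj i) ?_
  intro t
  choose y hy using fun i => hq (t i)
  exact ⟨y, funext hy⟩

/-- Right `add T`-approximations. -/
lemma Setup.approx (S : Setup Λ k T Q) (hX : Module.Finite Λ X) (h : EV Λ 1 T X) :
    ∃ (n : ℕ) (p : (Fin n → T) →ₗ[Λ] X), Surjective p ∧
      (∀ h : T →ₗ[Λ] X, ∃ l : T →ₗ[Λ] (Fin n → T), p ∘ₗ l = h) ∧
      Module.Finite Λ (LinearMap.ker p) ∧ EV Λ 1 T (LinearMap.ker p) := by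
  have := S.finT
  have := S.noeth
  obtain ⟨n, φ, hφ⟩ := homgen (Λ := Λ) k T X
  let p : (Fin n → T) →ₗ[Λ] X := ∑ i, φ i ∘ₗ LinearMap.proj i
  have hl : ∀ h : T →ₗ[Λ] X, ∃ l : T →ₗ[Λ] (Fin n → T), p ∘ₗ l = h := by
    intro h
    obtain ⟨c, rfl⟩ := hφ h
    refine ⟨LinearMap.pi fun i => scal Λ (c i) T, ?_⟩
    ext x
    simp [p]
  have hp : Surjective p := by
    intro x
    obtain ⟨m, g, y, rfl⟩ := S.gen X hX h x
    choose l hl using fun i : Fin m => hl (g ∘ₗ LinearMap.single Λ (fun _ => T) i)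
    refine ⟨∑ i, l i (y i), ?_⟩
    conv_rhs => rw [← Finset.univ_sum_single y]
    rw [map_sum, map_sum]
    exact Finset.sum_congr rfl fun i _ => LinearMap.congr_fun (hl i) (y i)
  refine ⟨n, p, hp, hl, inferInstance, ?_⟩
  exact ev_of_lift (LinearMap.ker p).subtype p (Submodule.subtype_injective _) hp (by simp)
    (S.ev_pow n) hl

/-- Modules in `Gen T` are in `Gen Q`. -/
lemma Setup.genQ (S : Setup Λ k T Q) (hX : Module.Finite Λ X) (h : EV Λ 1 T X) :
    ∃ (n : ℕ) (p : (Fin n → Q) →ₗ[Λ] X), Surjective p := by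
  obtain ⟨n, p, hp, -⟩ := S.approx hX h
  obtain ⟨q, hq⟩ := S.quot
  refine ⟨n, p ∘ₗ LinearMap.pi fun i => q ∘ₗ LinearMap.proj i, ?_⟩
  intro x
  obtain ⟨t, rfl⟩ := hp x
  choose y hy using fun i => hq (t i)
  exact ⟨y, congrArg p (funext hy)⟩

lemma Setup.shiftG (S : Setup Λ k T Q) (hX : Module.Finite Λ X) (h : EV Λ 1 T X) {i : ℕ}
    (hF : PD Λ (i + 2) F) : EV Λ (i + 1) F X := by
  obtain ⟨n, p, hp⟩ := S.genQ hX h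
  exact evc_right (LinearMap.ker p).subtype p (Submodule.subtype_injective _) hp (by simp)
    (ev_inj (inj_pow n S.injQ)) (hF.ev le_rfl)

/-- Postcomposition, as a map of modules over `End(T)ᵒᵖ`. -/
def postc (T : Type) [AddCommGroup T] [Module Λ T] (f : X →ₗ[Λ] Y) :
    (T →ₗ[Λ] X) →ₗ[(Module.End Λ T)ᵐᵒᵖ] (T →ₗ[Λ] Y) where
  toFun h := f ∘ₗ h
  map_add' a b := LinearMap.comp_add _ _ _
  map_smul' b a := rfl

/-- `Hom(T, T^n) ≃ B^n`. -/
def homPow (T : Type) [AddCommGroup T] [Module Λ T] (n : ℕ) :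
    (T →ₗ[Λ] (Fin n → T)) ≃ₗ[(Module.End Λ T)ᵐᵒᵖ] (Fin n → (Module.End Λ T)ᵐᵒᵖ) where
  toFun h i := MulOpposite.op (LinearMap.proj i ∘ₗ h)
  invFun b := LinearMap.pi fun i => (b i).unop
  map_add' a b := rfl
  map_smul' b a := rfl
  left_inv h := rfl
  right_inv b := rfl

lemma projHomPow (n : ℕ) :
    Module.Projective (Module.End Λ T)ᵐᵒᵖ (T →ₗ[Λ] (Fin n → T)) :=
  Module.Projective.of_equiv (homPow T n).symm

lemma postc_exact (p : X →ₗ[Λ] Y) :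
    LinearMap.range (postc T (LinearMap.ker p).subtype) = LinearMap.ker (postc T p) := by
  ext h
  constructor
  · rintro ⟨a, rfl⟩
    rw [LinearMap.mem_ker]
    apply LinearMap.ext
    intro x
    exact (a x).2
  · intro hh
    have hh' : p ∘ₗ h = 0 := hh
    exact ⟨LinearMap.codRestrict _ h fun x => LinearMap.congr_fun hh' x, rfl⟩

lemma postc_inj (f : X →ₗ[Λ] Y) (hf : Injective f) : Injective (postc T f) := by
  intro a b hab
  ext x
  exact hf (LinearMap.congr_fun hab x)

lemma Setup.pdHom (S : Setup Λ k T Q) (j : ℕ) : ∀ (M : Type) [AddCommGroup M] [Module Λ M],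
    Module.Finite Λ M → EV Λ 1 T M →
    (∀ (X : Type) [AddCommGroup X] [Module Λ X], Module.Finite Λ X → EV Λ 1 T X →
      EV Λ (j + 1) M X) → PD (Module.End Λ T)ᵐᵒᵖ (j + 1) (T →ₗ[Λ] M) := by
  induction j with
  | zero =>
    intro M _ _ hM hT hE
    obtain ⟨n, p, hp, hl, hf, hk⟩ := S.approx hM hT
    obtain ⟨s, hs⟩ := ev_lift (LinearMap.ker p).subtype p (Submodule.subtype_injective _) hp
      (by simp) (hE _ hf hk) LinearMap.id
    rw [zero_add, pd_one_iff]
    have := projHomPow (Λ := Λ) (T := T) n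
    refine Module.Projective.of_split (postc T s) (postc T p) ?_
    apply LinearMap.ext
    intro h
    change p ∘ₗ s ∘ₗ h = h
    rw [← LinearMap.comp_assoc, hs, LinearMap.id_comp]
  | succ j ih =>
    intro M _ _ hM hT hE
    obtain ⟨n, p, hp, hl, hf, hk⟩ := S.approx hM hT
    refine pd_right (postc T (LinearMap.ker p).subtype) (postc T p)
      (postc_inj _ (Submodule.subtype_injective _)) hl (postc_exact p) (ih _ hf hk ?_)
      ((pd_one_iff.2 (projHomPow n)).mono (by omega))
    intro X _ _ hX hX'
    refine ev_left (LinearMap.ker p).subtype p (Submodule.subtype_injective _) hp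
      (by simp) (_root_.ev_pow n ?_) (hE X hX hX')
    rcases j with _ | j
    · exact hX'
    · exact S.pdT.ev (by omega)

lemma Setup.pdRev (S : Setup Λ k T Q) (j : ℕ) : ∀ (M : Type) [AddCommGroup M] [Module Λ M],
    Module.Finite Λ M → EV Λ 1 T M → PD (Module.End Λ T)ᵐᵒᵖ (j + 1) (T →ₗ[Λ] M) →
    PD Λ (j + 2) M := by
  induction j with
  | zero =>
    intro M _ _ hM hT hE
    obtain ⟨n, p, hp, hl, hf, hk⟩ := S.approx hM hT
    rw [zero_add, pd_one_iff] at hE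
    obtain ⟨s, hs⟩ := Module.projective_lifting_property (postc T p) LinearMap.id hl
    have hs' : ∀ h : T →ₗ[Λ] M, p ∘ₗ s h = h := fun h => LinearMap.congr_fun hs h
    let ι : Fin n → T →ₗ[Λ] (Fin n → T) := fun i => LinearMap.single Λ (fun _ => T) i
    let φ : (Fin n → T) →ₗ[Λ] (Fin n → T) := ∑ i, s (p ∘ₗ ι i) ∘ₗ LinearMap.proj i
    have hφ : ∀ h : T →ₗ[Λ] (Fin n → T), φ ∘ₗ h = s (p ∘ₗ h) := by
      intro h
      have h1 : p ∘ₗ h = ∑ i, (MulOpposite.op (LinearMap.proj i ∘ₗ h) : (Module.End Λ T)ᵐᵒᵖ) •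
          (p ∘ₗ ι i) := by
        ext x
        rw [LinearMap.comp_apply]
        conv_lhs => rw [← Finset.univ_sum_single (h x)]
        rw [map_sum, LinearMap.sum_apply]
        rfl
      rw [h1, map_sum]
      ext x
      simp only [φ, LinearMap.comp_apply, LinearMap.sum_apply, map_smul]
      rfl
    have hk0 : LinearMap.ker p ≤ LinearMap.ker φ := by
      intro x hx
      obtain ⟨m, g, y, hy⟩ := S.gen _ hf hk ⟨x, hx⟩
      have hg : ∀ i t, φ (g (LinearMap.single Λ (fun _ => T) i t) : Fin n → T) = 0 := by
        intro i t
        have h1 := hφ ((LinearMap.ker p).subtype ∘ₗ g ∘ₗ LinearMap.single Λ (fun _ => T) i)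
        have h2 : p ∘ₗ ((LinearMap.ker p).subtype ∘ₗ g ∘ₗ LinearMap.single Λ (fun _ => T) i) = 0 := by
          ext t
          exact (g _).2
        rw [h2, map_zero] at h1
        exact LinearMap.congr_fun h1 t
      have h3 : φ ((LinearMap.ker p).subtype (g y)) = 0 := by
        rw [← Finset.univ_sum_single y, map_sum, map_sum, map_sum]
        exact Finset.sum_eq_zero fun i _ => hg i (y i)
      rw [hy] at h3
      exact h3
    let e := p.quotKerEquivOfSurjective hp
    let σ : M →ₗ[Λ] (Fin n → T) := (LinearMap.ker p).liftQ φ hk0 ∘ₗ e.symm.toLinearMap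
    have hσ : ∀ x, σ (p x) = φ x := by
      intro x
      have : e.symm (p x) = (LinearMap.ker p).mkQ x := by
        rw [LinearEquiv.symm_apply_eq]; rfl
      simp only [σ, LinearMap.comp_apply, LinearEquiv.coe_coe]
      rw [this]
      simp
    refine pd_retract σ p ?_ (pd_pow n S.pdT)
    ext m
    obtain ⟨x, rfl⟩ := hp m
    rw [LinearMap.comp_apply, hσ, LinearMap.id_apply]
    conv_rhs => rw [← Finset.univ_sum_single x]
    conv_lhs => rw [← Finset.univ_sum_single x]
    rw [map_sum, map_sum, map_sum]
    refine Finset.sum_congr rfl fun i _ => ?_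
    have h1 : φ (Pi.single i (x i)) = s (p ∘ₗ ι i) (x i) := LinearMap.congr_fun (hφ (ι i)) (x i)
    rw [h1]
    exact LinearMap.congr_fun (hs' (p ∘ₗ ι i)) (x i)
  | succ j ih =>
    intro M _ _ hM hT hE
    obtain ⟨n, p, hp, hl, hf, hk⟩ := S.approx hM hT
    refine pd_right (LinearMap.ker p).subtype p (Submodule.subtype_injective _) hp (by simp)
      (ih _ hf hk ?_) ((pd_pow n S.pdT).mono (by omega))
    exact pd_left (postc T (LinearMap.ker p).subtype) (postc T p)
      (postc_inj _ (Submodule.subtype_injective _)) hl (postc_exact p)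
      ((pd_one_iff.2 (projHomPow n)).mono (by omega)) hE

end BPart

section MainPart

variable {Λ : Type} [Ring Λ] {k : Type} [CommRing k] [IsArtinianRing k] [Algebra k Λ]
    [Module.Finite k Λ] {T Q : Type} [AddCommGroup T] [Module Λ T]
    [AddCommGroup Q] [Module Λ Q]

lemma Setup.homT_zero (S : Setup Λ k T Q) {F : Type} [AddCommGroup F] [Module Λ F]
    (h : ∀ a : Q →ₗ[Λ] F, a = 0) (a : T →ₗ[Λ] F) : a = 0 := by
  obtain ⟨q, hq⟩ := S.quot
  ext t
  obtain ⟨x, rfl⟩ := hq t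
  exact LinearMap.congr_fun (h (a ∘ₗ q)) x

lemma Setup.fwd (S : Setup Λ k T Q) (e : ℕ)
    (hF : ∀ (F : Type) [AddCommGroup F] [Module Λ F], Module.Finite Λ F →
      (∀ a : Q →ₗ[Λ] F, a = 0) → PD Λ (e + 2) F)
    (hgl : ∀ (X : Type) [AddCommGroup X] [Module Λ X], Module.Finite Λ X → PD Λ (e + 3) X) :
    GlobalDimLE (Module.End Λ T)ᵐᵒᵖ (e + 1) := by
  intro Y hY
  have := S.noeth
  have := S.finT
  have := S.finQ
  have := S.projQ
  have := endNoeth (Λ := Λ) k T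
  apply pdLEcat_of_pd _ _ hY
  obtain ⟨n, g, hg⟩ := Module.Finite.exists_fin' (Module.End Λ T)ᵐᵒᵖ Y
  let π : (T →ₗ[Λ] (Fin n → T)) →ₗ[(Module.End Λ T)ᵐᵒᵖ] Y := g ∘ₗ (homPow T n).toLinearMap
  have hπ : Surjective π := hg.comp (homPow T n).surjective
  have : Module.Finite (Module.End Λ T)ᵐᵒᵖ (T →ₗ[Λ] (Fin n → T)) :=
    Module.Finite.equiv (homPow T n).symm
  obtain ⟨m, g', hg'⟩ := Module.Finite.exists_fin' (Module.End Λ T)ᵐᵒᵖ (LinearMap.ker π)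
  let u : (Fin m → T) →ₗ[Λ] (Fin n → T) := ∑ j, (g' (Pi.single j 1)).1 ∘ₗ LinearMap.proj j
  have hu : ∀ w : T →ₗ[Λ] (Fin m → T), u ∘ₗ w = (g' (homPow T m w)).1 := by
    intro w
    conv_rhs => rw [← Finset.univ_sum_single (homPow T m w)]
    rw [map_sum, Submodule.coe_sum]
    have : ∀ j, (Pi.single j (homPow T m w j) : Fin m → (Module.End Λ T)ᵐᵒᵖ)
        = homPow T m w j • Pi.single j 1 := by
      intro j
      rw [← Pi.single_smul]; simp
    simp only [this, map_smul]
    ext x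
    simp only [u, LinearMap.comp_apply, LinearMap.sum_apply]
    rfl
  -- the trace of `Q` in the kernel of `u`
  obtain ⟨r, φ, hφ⟩ := homgen (Λ := Λ) k Q (LinearMap.ker u)
  let w : (Fin r → Q) →ₗ[Λ] (Fin m → T) :=
    ∑ i, ((LinearMap.ker u).subtype ∘ₗ φ i) ∘ₗ LinearMap.proj i
  have hw : ∀ z, u (w z) = 0 := by
    intro z
    simp only [w, LinearMap.sum_apply, map_sum]
    exact Finset.sum_eq_zero fun i _ => (φ i (z i)).2
  have hw' : ∀ (h : Q →ₗ[Λ] (Fin m → T)), u ∘ₗ h = 0 → ∀ x, h x ∈ LinearMap.range w := by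
    intro h hh x
    obtain ⟨c, hc⟩ := hφ (LinearMap.codRestrict _ h fun x => LinearMap.congr_fun hh x)
    refine ⟨fun i => scal Λ (c i) Q x, ?_⟩
    have h1 : h x = (LinearMap.ker u).subtype ((∑ i, φ i ∘ₗ scal Λ (c i) Q) x) := by
      rw [← hc]; rfl
    rw [h1]
    simp [w]
  have hwu : LinearMap.range w ≤ LinearMap.ker u := by
    rintro _ ⟨z, rfl⟩
    exact hw z
  have hEw : EV Λ 1 T (LinearMap.range w) := S.ev_quotQ r w.rangeRestrict w.surjective_rangeRestrict
  let M := (Fin m → T) ⧸ LinearMap.range w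
  let mk : (Fin m → T) →ₗ[Λ] M := (LinearMap.range w).mkQ
  have hmk : Surjective mk := Submodule.mkQ_surjective _
  have hMT : EV Λ 1 T M := S.ev_quot mk hmk (S.ev_pow m)
  have hMf : Module.Finite Λ M := Module.Finite.of_surjective mk hmk
  let u' : M →ₗ[Λ] (Fin n → T) := (LinearMap.range w).liftQ u hwu
  have hu' : ∀ x, u' (mk x) = u x := fun x => rfl
  have hlift : ∀ h : T →ₗ[Λ] M, ∃ l, mk ∘ₗ l = h :=
    ev_lift (LinearMap.range w).subtype mk (Submodule.subtype_injective _) hmk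
      (by rw [Submodule.range_subtype]; exact (Submodule.ker_mkQ _).symm) hEw
  have hFQ : ∀ a : Q →ₗ[Λ] LinearMap.ker u', a = 0 := by
    intro a
    obtain ⟨l, hl⟩ := Module.projective_lifting_property mk ((LinearMap.ker u').subtype ∘ₗ a) hmk
    have hl' : ∀ x, mk (l x) = (a x).1 := fun x => LinearMap.congr_fun hl x
    have h1 : u ∘ₗ l = 0 := by
      apply LinearMap.ext
      intro x
      have : u' (mk (l x)) = 0 := by rw [hl']; exact (a x).2
      exact this
    apply LinearMap.ext
    intro x
    apply Subtype.ext
    rw [← hl']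
    exact (Submodule.Quotient.mk_eq_zero _).2 (hw' l h1 x)
  have hFf : Module.Finite Λ (LinearMap.ker u') := inferInstance
  have hpd : PD (Module.End Λ T)ᵐᵒᵖ (e + 1) (T →ₗ[Λ] M) := by
    refine S.pdHom e M hMf hMT ?_
    intro X _ _ hX hX'
    refine ev_mid (LinearMap.ker u').subtype u'.rangeRestrict (Submodule.subtype_injective _)
      u'.surjective_rangeRestrict (by simp) (S.shiftG hX hX' (hF _ hFf hFQ)) ?_
    refine ev_left (LinearMap.range u').subtype (LinearMap.range u').mkQ
      (Submodule.subtype_injective _) (Submodule.mkQ_surjective _) (by simp) (_root_.ev_pow n ?_)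
      (S.shiftG hX hX' (hgl _ inferInstance))
    rcases e with _ | e
    · exact hX'
    · exact S.pdT.ev (by omega)
  refine pd_right (postc T u') π ?_ hπ ?_ hpd ((pd_one_iff.2 (projHomPow n)).mono (by omega))
  · refine (injective_iff_map_eq_zero _).2 ?_
    intro a ha
    have ha' : ∀ x, u' (a x) = 0 := fun x => LinearMap.congr_fun ha x
    have := S.homT_zero hFQ (LinearMap.codRestrict (LinearMap.ker u') a ha')
    apply LinearMap.ext
    intro x
    exact congrArg Subtype.val (LinearMap.congr_fun this x)
  · ext h
    constructor
    · rintro ⟨a, rfl⟩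
      obtain ⟨l, rfl⟩ := hlift a
      have : postc T u' (mk ∘ₗ l) = u ∘ₗ l := rfl
      rw [this, hu]
      exact (g' (homPow T m l)).2
    · intro hh
      obtain ⟨b, hb⟩ := hg' ⟨h, hh⟩
      refine ⟨mk ∘ₗ (homPow T m).symm b, ?_⟩
      have : postc T u' (mk ∘ₗ (homPow T m).symm b) = u ∘ₗ (homPow T m).symm b := rfl
      rw [this, hu, LinearEquiv.apply_symm_apply, hb]

lemma Setup.rev (S : Setup Λ k T Q) (e : ℕ) (hB : GlobalDimLE (Module.End Λ T)ᵐᵒᵖ (e + 1))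
    (F : Type) [AddCommGroup F] [Module Λ F] (hF : Module.Finite Λ F)
    (hFQ : ∀ a : Q →ₗ[Λ] F, a = 0) : PD Λ (e + 2) F := by
  have := S.noeth
  have := S.finT
  obtain ⟨m, p, hp⟩ := Module.Finite.exists_fin' Λ T
  have hpex : LinearMap.range (LinearMap.ker p).subtype = LinearMap.ker p := by simp
  obtain ⟨n, φ, hφ⟩ := homgen (Λ := Λ) k (LinearMap.ker p) F
  let P0 := Fin m → Λ
  let j : LinearMap.ker p →ₗ[Λ] P0 := (LinearMap.ker p).subtype
  let Φ : (Fin n → LinearMap.ker p) →ₗ[Λ] F := ∑ i, φ i ∘ₗ LinearMap.proj i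
  let J : (Fin n → LinearMap.ker p) →ₗ[Λ] (Fin n → P0) :=
    LinearMap.pi fun i => j ∘ₗ LinearMap.proj i
  let δ : (Fin n → LinearMap.ker p) →ₗ[Λ] F × (Fin n → P0) := LinearMap.prod (-Φ) J
  let E := (F × (Fin n → P0)) ⧸ LinearMap.range δ
  let mk : (F × (Fin n → P0)) →ₗ[Λ] E := (LinearMap.range δ).mkQ
  have hmk : Surjective mk := Submodule.mkQ_surjective _
  have hmk0 : ∀ z, mk z = 0 ↔ ∃ y, δ y = z := fun z => Submodule.Quotient.mk_eq_zero _
  let iF : F →ₗ[Λ] E := mk ∘ₗ LinearMap.inl Λ _ _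
  have hiF : Injective iF := by
    refine (injective_iff_map_eq_zero _).2 ?_
    intro x hx
    obtain ⟨y, hy⟩ := (hmk0 _).1 hx
    have h2 : J y = 0 := congrArg Prod.snd hy
    have h1 : -Φ y = x := congrArg Prod.fst hy
    have hy0 : y = 0 := by
      funext i
      apply Subtype.ext
      exact congrFun h2 i
    rw [← h1, hy0, map_zero, neg_zero]
  let G0 : (F × (Fin n → P0)) →ₗ[Λ] (Fin n → T) :=
    (LinearMap.pi fun i => p ∘ₗ LinearMap.proj i) ∘ₗ LinearMap.snd Λ _ _
  have hG0 : LinearMap.range δ ≤ LinearMap.ker G0 := by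
    rintro _ ⟨y, rfl⟩
    rw [LinearMap.mem_ker]
    funext i
    exact (y i).2
  let G : E →ₗ[Λ] (Fin n → T) := (LinearMap.range δ).liftQ G0 hG0
  have hGmk : ∀ z, G (mk z) = G0 z := fun z => rfl
  have hG : Surjective G := by
    intro t
    choose z hz using fun i => hp (t i)
    exact ⟨mk (0, z), funext hz⟩
  have hGi : LinearMap.range iF = LinearMap.ker G := by
    ext x
    constructor
    · rintro ⟨a, rfl⟩
      rw [LinearMap.mem_ker]
      change G0 (a, 0) = 0
      funext i
      exact map_zero p
    · intro hx
      obtain ⟨⟨a, z⟩, rfl⟩ := hmk x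
      have hz : ∀ i, p (z i) = 0 := fun i => congrFun (LinearMap.mem_ker.1 hx) i
      let y : Fin n → LinearMap.ker p := fun i => ⟨z i, hz i⟩
      refine ⟨a + Φ y, ?_⟩
      rw [← sub_eq_zero]
      change mk (a + Φ y, 0) - mk (a, z) = 0
      rw [← map_sub, hmk0]
      refine ⟨-y, ?_⟩
      apply Prod.ext
      · change -Φ (-y) = a + Φ y - a
        rw [map_neg]; abel
      · change J (-y) = 0 - z
        rw [map_neg, zero_sub]
        rfl
  have hEf : Module.Finite Λ E := Module.Finite.of_surjective mk hmk
  have hTE : EV Λ 1 T E := by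
    refine ev_of_ext j p (Submodule.subtype_injective _) hp hpex
      ((pd_one_iff.2 inferInstance).ev le_rfl) ?_
    intro ψ
    obtain ⟨ρ0, hρ0⟩ := ev_ext j p (Submodule.subtype_injective _) hp hpex (S.ev_pow n) (G ∘ₗ ψ)
    obtain ⟨ρ, hρ⟩ := Module.projective_lifting_property G ρ0 hG
    have h1 : ∀ x, ∃ a, iF a = ψ x - ρ (j x) := by
      intro x
      have : ψ x - ρ (j x) ∈ LinearMap.range iF := by
        rw [hGi, LinearMap.mem_ker, map_sub]
        have h2 := LinearMap.congr_fun hρ (j x)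
        have h3 := LinearMap.congr_fun hρ0 x
        simp only [LinearMap.comp_apply] at h2 h3
        rw [h2, h3, sub_self]
      exact this
    let eF := LinearEquiv.ofInjective iF hiF
    let θ : LinearMap.ker p →ₗ[Λ] F := eF.symm.toLinearMap ∘ₗ
      LinearMap.codRestrict (LinearMap.range iF) (ψ - ρ ∘ₗ j) h1
    have hθ : ∀ x, iF (θ x) = ψ x - ρ (j x) := by
      intro x
      have : eF (θ x) = LinearMap.codRestrict (LinearMap.range iF) (ψ - ρ ∘ₗ j) h1 x :=
        eF.apply_symm_apply _
      exact congrArg Subtype.val this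
    obtain ⟨c, hc⟩ := hφ θ
    let ε : Fin n → P0 →ₗ[Λ] E := fun i =>
      mk ∘ₗ LinearMap.inr Λ _ _ ∘ₗ LinearMap.single Λ (fun _ => P0) i
    have hε : ∀ i y, iF (φ i y) = ε i (j y) := by
      intro i y
      rw [← sub_eq_zero]
      change mk (φ i y, 0) - mk (0, Pi.single i (j y)) = 0
      rw [← map_sub, hmk0]
      refine ⟨-Pi.single i y, ?_⟩
      apply Prod.ext
      · change -Φ (-Pi.single i y) = φ i y - 0
        rw [map_neg, neg_neg, sub_zero]
        simp only [Φ, LinearMap.sum_apply, LinearMap.comp_apply, LinearMap.proj_apply]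
        rw [Finset.sum_eq_single i]
        · simp
        · intro b _ hb
          simp [hb]
        · simp
      · change J (-Pi.single i y) = 0 - Pi.single i (j y)
        rw [map_neg, zero_sub]
        congr 1
        funext l
        change j ((Pi.single i y : Fin n → LinearMap.ker p) l) = _
        by_cases hl : l = i
        · subst hl; simp
        · simp [hl]
    refine ⟨ρ + ∑ i, ε i ∘ₗ scal Λ (c i) P0, ?_⟩
    ext x
    have h2 := hθ x
    rw [hc, LinearMap.sum_apply, map_sum, eq_sub_iff_add_eq] at h2
    rw [← h2, LinearMap.comp_apply, LinearMap.add_apply, LinearMap.sum_apply, add_comm]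
    congr 1
    refine Finset.sum_congr rfl fun i _ => ?_
    change ε i (scal Λ (c i) P0 (j x)) = iF (φ i (scal Λ (c i) _ x))
    rw [hε]
    rfl
  have hinj : Injective (postc T G) := by
    refine (injective_iff_map_eq_zero _).2 ?_
    intro a ha
    have ha' : ∀ x, a x ∈ LinearMap.range iF := by
      intro x
      rw [hGi]
      exact LinearMap.congr_fun ha x
    let eF := LinearEquiv.ofInjective iF hiF
    have h0 := S.homT_zero hFQ (eF.symm.toLinearMap ∘ₗ LinearMap.codRestrict _ a ha')
    apply LinearMap.ext
    intro x
    have h1 := LinearMap.congr_fun h0 x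
    simp only [LinearMap.comp_apply, LinearEquiv.coe_coe, LinearMap.zero_apply,
      LinearEquiv.map_eq_zero_iff] at h1
    exact congrArg Subtype.val h1
  have hYf : Module.Finite (Module.End Λ T)ᵐᵒᵖ (T →ₗ[Λ] (Fin n → T)) :=
    Module.Finite.equiv (homPow T n).symm
  have hY := pd_of_pdLEcat _ _ (hB (ModuleCat.of _
    ((T →ₗ[Λ] (Fin n → T)) ⧸ LinearMap.range (postc T G)))
    (inferInstanceAs (Module.Finite (Module.End Λ T)ᵐᵒᵖ
      ((T →ₗ[Λ] (Fin n → T)) ⧸ LinearMap.range (postc T G)))))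
  have hTE' : PD (Module.End Λ T)ᵐᵒᵖ (e + 1) (T →ₗ[Λ] E) :=
    pd_left (postc T G) (LinearMap.range (postc T G)).mkQ hinj (Submodule.mkQ_surjective _)
      (by simp) ((pd_one_iff.2 (projHomPow n)).mono (by omega)) hY
  have hE := S.pdRev e E hEf hTE hTE'
  exact pd_left iF G hiF hG hGi hE ((pd_pow n S.pdT).mono (by omega))

end MainPart

section ASPart

variable {Λ : Type} [Ring Λ] {A E C X : Type} [AddCommGroup A] [Module Λ A]
    [AddCommGroup E] [Module Λ E] [AddCommGroup C] [Module Λ C] [AddCommGroup X] [Module Λ X]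

lemma lift_inj (f : A →ₗ[Λ] E) (hf : Injective f) (h : X →ₗ[Λ] E)
    (hx : ∀ x, h x ∈ LinearMap.range f) : ∃ l : X →ₗ[Λ] A, ∀ x, f (l x) = h x := by
  refine ⟨(LinearEquiv.ofInjective f hf).symm.toLinearMap ∘ₗ LinearMap.codRestrict _ h hx, ?_⟩
  intro x
  have := (LinearEquiv.ofInjective f hf).apply_symm_apply (LinearMap.codRestrict _ h hx x)
  exact congrArg Subtype.val this

lemma lift_surj (g : E →ₗ[Λ] C) (hg : Surjective g) (h : E →ₗ[Λ] X)
    (hx : ∀ x, g x = 0 → h x = 0) : ∃ l : C →ₗ[Λ] X, ∀ x, l (g x) = h x := by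
  refine ⟨(LinearMap.ker g).liftQ h (fun x hx' => hx x hx') ∘ₗ
    (g.quotKerEquivOfSurjective hg).symm.toLinearMap, ?_⟩
  intro x
  have : (g.quotKerEquivOfSurjective hg).symm (g x) = (LinearMap.ker g).mkQ x := by
    rw [LinearEquiv.symm_apply_eq]; rfl
  rw [LinearMap.comp_apply, LinearEquiv.coe_coe, this]
  rfl

lemma sec_ret (f : A →ₗ[Λ] E) (g : E →ₗ[Λ] C) (hf : Injective f)
    (hfg : LinearMap.range f = LinearMap.ker g) (s : C →ₗ[Λ] E) (hs : ∀ x, g (s x) = x) :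
    ∃ r : E →ₗ[Λ] A, r ∘ₗ f = LinearMap.id := by
  obtain ⟨r, hr⟩ := lift_inj f hf (LinearMap.id - s ∘ₗ g) (by
    intro x
    rw [hfg, LinearMap.mem_ker]
    simp [hs])
  refine ⟨r, ?_⟩
  ext a
  apply hf
  have h0 : g (f a) = 0 := by
    have : f a ∈ LinearMap.ker g := hfg ▸ ⟨a, rfl⟩
    exact this
  rw [LinearMap.comp_apply, hr]
  simp [h0]

lemma ret_sec (f : A →ₗ[Λ] E) (g : E →ₗ[Λ] C) (hg : Surjective g)
    (hfg : LinearMap.range f = LinearMap.ker g) (r : E →ₗ[Λ] A) (hr : ∀ x, r (f x) = x) :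
    ∃ s : C →ₗ[Λ] E, ∀ x, g (s x) = x := by
  have h0 : ∀ a, g (f a) = 0 := by
    intro a
    have : f a ∈ LinearMap.ker g := hfg ▸ ⟨a, rfl⟩
    exact this
  obtain ⟨s, hs⟩ := lift_surj g hg (LinearMap.id - f ∘ₗ r) (by
    intro x hx
    have : x ∈ LinearMap.range f := by rw [hfg]; exact hx
    obtain ⟨a, rfl⟩ := this
    simp [hr])
  refine ⟨s, ?_⟩
  intro x
  obtain ⟨y, rfl⟩ := hg x
  rw [hs]
  simp [h0]

/-- A simple module `S` with `Ext¹(C, S) ≠ 0` embeds into the left end term of the almost split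
sequence ending at `C`. -/
lemma as_simple [IsNoetherianRing Λ] (f : A →ₗ[Λ] E) (g : E →ₗ[Λ] C)
    (has : IsAlmostSplitSeq Λ f g) (hC : Module.Finite Λ C) [IsSimpleModule Λ X]
    (h : ¬ EV Λ 1 C X) : ∃ i : X →ₗ[Λ] A, Injective i := by
  obtain ⟨hf, hg, hfg, hns, -, -, hlift⟩ := has
  have h' : ¬ Ext1Vanish Λ C X := fun h1 => h (ev_of_ext1Vanish h1)
  unfold Ext1Vanish at h'
  push Not at h'
  obtain ⟨E', f', g', hf', hg', hfg', hr⟩ := h'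
  have hfin : Module.Finite Λ E' := by
    have h1 : IsNoetherian Λ X := inferInstance
    have h2 : IsNoetherian Λ C := isNoetherian_of_isNoetherianRing_of_finite Λ C
    have : IsNoetherian Λ E' := isNoetherian_of_range_eq_ker f' g' hfg'
    infer_instance
  obtain ⟨l, hl⟩ := hlift E' g' hfin (by
    rintro ⟨s, hs⟩
    obtain ⟨r, hr'⟩ := sec_ret f' g' hf' hfg' s (fun x => LinearMap.congr_fun hs x)
    exact hr r hr')
  have h0' : ∀ a, g' (f' a) = 0 := by
    intro a
    have : f' a ∈ LinearMap.ker g' := hfg' ▸ ⟨a, rfl⟩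
    exact this
  obtain ⟨i, hi⟩ := lift_inj f hf (l ∘ₗ f') (by
    intro x
    rw [hfg, LinearMap.mem_ker]
    exact (LinearMap.congr_fun hl (f' x)).trans (h0' x))
  refine ⟨i, ?_⟩
  rcases LinearMap.injective_or_eq_zero i with h1 | h1
  · exact h1
  exfalso
  obtain ⟨s, hs⟩ := lift_surj g' hg' l (by
    intro x hx
    have : x ∈ LinearMap.range f' := by rw [hfg']; exact hx
    obtain ⟨a, rfl⟩ := this
    have := hi a
    rw [h1] at this
    simpa using this.symm)
  apply hns
  refine sec_ret f g hf hfg s ?_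
  intro x
  obtain ⟨y, rfl⟩ := hg' x
  rw [hs]
  exact LinearMap.congr_fun hl y

lemma fitting_nil [IsNoetherian Λ A] [IsArtinian Λ A] (hA : Indecomposable Λ A)
    (θ : Module.End Λ A) (x : A) (hx : x ≠ 0) (hθ : θ x = 0) : ∃ n, θ ^ n = 0 := by
  obtain ⟨n, hn, hn1⟩ := ((LinearMap.eventually_isCompl_ker_pow_range_pow θ).and
    (Filter.eventually_ge_atTop 1)).exists
  refine ⟨n, ?_⟩
  have hxk : x ∈ LinearMap.ker (θ ^ n) := by
    obtain ⟨m, rfl⟩ := Nat.exists_eq_add_of_le' hn1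
    rw [LinearMap.mem_ker, pow_succ, Module.End.mul_apply, hθ, map_zero]
  rcases hA.2 (Submodule.projection _ _ hn) (by
    ext y
    exact Submodule.projection_apply_of_mem_left hn (Submodule.projection_apply_mem hn y)) with h | h
  · exfalso
    apply hx
    rw [← Submodule.projection_apply_of_mem_left hn hxk, h]
    rfl
  · ext y
    have h1 : y ∈ LinearMap.ker (θ ^ n) := by
      have := Submodule.projection_apply_mem hn y
      rwa [h] at this
    exact h1

/-- `Hom(Q, τ C) = 0`. -/
lemma as_hom_zero [IsNoetherianRing Λ] [IsArtinianRing Λ] (f : A →ₗ[Λ] E) (g : E →ₗ[Λ] C)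
    (has : IsAlmostSplitSeq Λ f g) (hC : Module.Finite Λ C) (hA : Module.Finite Λ A)
    {Q : Type} [AddCommGroup Q] [Module Λ Q] (hQ : Module.Injective Λ Q) (hpd : PD Λ 2 C)
    (a : Q →ₗ[Λ] A) : a = 0 := by
  obtain ⟨hf, hg, hfg, hns, hAi, -, hlift⟩ := has
  by_contra ha
  obtain ⟨y, hy⟩ : ∃ y, a y ≠ 0 := by
    by_contra hcon
    push Not at hcon
    exact ha (LinearMap.ext hcon)
  have h0 : ∀ a, g (f a) = 0 := by
    intro a
    have : f a ∈ LinearMap.ker g := hfg ▸ ⟨a, rfl⟩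
    exact this
  let J := LinearMap.range (f ∘ₗ a)
  have hJ : EV Λ 1 C J := evc_right (LinearMap.ker (f ∘ₗ a)).subtype (f ∘ₗ a).rangeRestrict
    (Submodule.subtype_injective _) (LinearMap.surjective_rangeRestrict _) (by simp)
    (ev_inj hQ) (hpd.ev le_rfl)
  have hEfin : Module.Finite Λ E := by
    have h1 : IsNoetherian Λ A := isNoetherian_of_isNoetherianRing_of_finite Λ A
    have h2 : IsNoetherian Λ C := isNoetherian_of_isNoetherianRing_of_finite Λ C
    have : IsNoetherian Λ E := isNoetherian_of_range_eq_ker f g hfg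
    infer_instance
  let h : (E ⧸ J) →ₗ[Λ] C := J.liftQ g (by
    rintro _ ⟨z, rfl⟩
    exact h0 _)
  have hh : ∀ x, h (J.mkQ x) = g x := fun x => rfl
  obtain ⟨l, hl⟩ := hlift (ModuleCat.of Λ (E ⧸ J)) h
    (inferInstanceAs (Module.Finite Λ (E ⧸ J))) (by
      rintro ⟨s, hs⟩
      obtain ⟨t, ht⟩ := ev_lift J.subtype J.mkQ (Submodule.subtype_injective _)
        (Submodule.mkQ_surjective _) (by simp) hJ s
      apply hns
      refine sec_ret f g hf hfg t ?_
      intro x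
      rw [← hh]
      have h1 := LinearMap.congr_fun ht x
      have h2 := LinearMap.congr_fun hs x
      rw [LinearMap.comp_apply] at h1
      rw [h1]
      exact h2)
  let φ : Module.End Λ E := l ∘ₗ J.mkQ
  have hφ : ∀ x, g (φ x) = g x := fun x => LinearMap.congr_fun hl (J.mkQ x)
  obtain ⟨θ, hθ⟩ := lift_inj f hf (φ ∘ₗ f) (by
    intro x
    rw [hfg, LinearMap.mem_ker]
    exact (hφ _).trans (h0 x))
  have hθy : θ (a y) = 0 := by
    apply hf
    rw [hθ, map_zero]
    have : J.mkQ (f (a y)) = 0 := (Submodule.Quotient.mk_eq_zero _).2 ⟨y, rfl⟩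
    change l (J.mkQ (f (a y))) = 0
    rw [this, map_zero]
  obtain ⟨n, hn⟩ := fitting_nil hAi θ (a y) hy hθy
  have hpow : ∀ n x, f ((θ ^ n) x) = (φ ^ n) (f x) := by
    intro n
    induction n with
    | zero => intro x; rfl
    | succ n ih =>
      intro x
      rw [pow_succ, pow_succ, Module.End.mul_apply, Module.End.mul_apply, ih, hθ]
      rfl
  have hgpow : ∀ n x, g ((φ ^ n) x) = g x := by
    intro n
    induction n with
    | zero => intro x; rfl
    | succ n ih =>
      intro x
      rw [pow_succ, Module.End.mul_apply, ih, hφ]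
  obtain ⟨s, hs⟩ := lift_surj g hg (φ ^ n) (by
    intro x hx
    have : x ∈ LinearMap.range f := by rw [hfg]; exact hx
    obtain ⟨b, rfl⟩ := this
    rw [← hpow, hn]
    simp)
  apply hns
  refine sec_ret f g hf hfg s ?_
  intro x
  obtain ⟨z, rfl⟩ := hg x
  rw [hs, hgpow]

end ASPart

section FinalPart

variable {Λ : Type} [Ring Λ]

lemma inj_retract {X Y : Type} [AddCommGroup X] [Module Λ X] [AddCommGroup Y] [Module Λ Y]
    (s : X →ₗ[Λ] Y) (p : Y →ₗ[Λ] X) (h : ∀ x, p (s x) = x) (hY : Module.Injective Λ Y) :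
    Module.Injective Λ X := by
  constructor
  intro A B _ _ _ _ f hf g
  obtain ⟨l, hl⟩ := hY.out f hf (s ∘ₗ g)
  refine ⟨p ∘ₗ l, fun x => ?_⟩
  rw [LinearMap.comp_apply, hl, LinearMap.comp_apply, h]

/-- Dominant dimension at least two and global dimension at most one force semisimplicity. -/
lemma gldim_ne_one [IsNoetherianRing Λ] (hdom : DomdimGE2 Λ)
    (hgl : ∀ (X : Type) [AddCommGroup X] [Module Λ X], Module.Finite Λ X → PD Λ 2 X) :
    GlobalDimLE Λ 0 := by
  obtain ⟨Q0, Q1, f, g, _, hQ0, _, hQ1, hf, hfg⟩ := hdom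
  have hR : PD Λ 1 (LinearMap.range g) :=
    pd_left (LinearMap.range g).subtype (LinearMap.range g).mkQ (Submodule.subtype_injective _)
      (Submodule.mkQ_surjective _) (by simp) (pd_one_iff.2 hQ1.1) (hgl _ inferInstance)
  have hR' := pd_one_iff.1 hR
  obtain ⟨s, hs⟩ := Module.projective_lifting_property g.rangeRestrict LinearMap.id
    g.surjective_rangeRestrict
  obtain ⟨r, hr⟩ := sec_ret f g.rangeRestrict hf (by rw [LinearMap.ker_rangeRestrict, hfg]) s
    (fun x => LinearMap.congr_fun hs x)
  have hΛ : Module.Injective Λ Λ := inj_retract f r (fun x => LinearMap.congr_fun hr x) hQ0.2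
  have hproj : ∀ (K : Type) [AddCommGroup K] [Module Λ K], Module.Finite Λ K →
      Module.Projective Λ K → Module.Injective Λ K := by
    intro K _ _ _ _
    obtain ⟨n, p, hp⟩ := Module.Finite.exists_fin' Λ K
    obtain ⟨t, ht⟩ := Module.projective_lifting_property p LinearMap.id hp
    exact inj_retract t p (fun x => LinearMap.congr_fun ht x) (inj_pow n hΛ)
  intro X hX
  obtain ⟨n, p, hp⟩ := Module.Finite.exists_fin' Λ X
  have hK : Module.Projective Λ (LinearMap.ker p) := pd_one_iff.1
    (pd_left (LinearMap.ker p).subtype p (Submodule.subtype_injective _) hp (by simp)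
      (pd_one_iff.2 inferInstance) (hgl X hX))
  obtain ⟨r', hr'⟩ := (hproj _ inferInstance hK).out (LinearMap.ker p).subtype
    (Submodule.subtype_injective _) LinearMap.id
  obtain ⟨t, ht⟩ := ret_sec (LinearMap.ker p).subtype p hp (by simp) r' hr'
  exact Module.Projective.of_split t p (LinearMap.ext ht)

lemma pd_filt {Q : Type} [AddCommGroup Q] [Module Λ Q] (hQ : Module.Projective Λ Q) (n : ℕ)
    (hsim : ∀ (X : Type) [AddCommGroup X] [Module Λ X], IsSimpleModule Λ X →
      (∀ a : Q →ₗ[Λ] X, a = 0) → PD Λ (n + 1) X)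
    (F : Type) [AddCommGroup F] [Module Λ F] (hF : IsFiniteLength Λ F)
    (hFQ : ∀ a : Q →ₗ[Λ] F, a = 0) : PD Λ (n + 1) F := by
  induction hF with
  | of_subsingleton => exact (pd_one_iff.2 inferInstance).mono (by omega)
  | @of_simple_quotient M _ _ K hK _ ih =>
    refine pd_mid K.subtype K.mkQ (Submodule.subtype_injective _) (Submodule.mkQ_surjective _)
      (by simp) (ih ?_) (hsim _ hK ?_)
    · intro a
      have := hFQ (K.subtype ∘ₗ a)
      ext x
      exact LinearMap.congr_fun this x
    · intro a
      obtain ⟨l, hl⟩ := Module.projective_lifting_property K.mkQ a (Submodule.mkQ_surjective _)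
      rw [← hl, hFQ l, LinearMap.comp_zero]

lemma mkSetup (k : Type) [CommRing k] [IsArtinianRing k] [Algebra k Λ]
    [Module.Finite k Λ] (T : Type) [AddCommGroup T] [Module Λ T] (hfT : Module.Finite Λ T)
    (hT : IsTilting Λ T) (Q : Type) [AddCommGroup Q] [Module Λ Q] (hfQ : Module.Finite Λ Q)
    (hQ : IsProjInj Λ Q) (q : Q →ₗ[Λ] T) (hq : Surjective q) : Setup Λ k T Q where
  noeth := IsNoetherianRing.of_finite k Λ
  art := IsArtinianRing.of_finite k Λ
  finT := hfT
  finQ := hfQ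
  projQ := hQ.1
  injQ := hQ.2
  pdT := pd_of_pdLE hT.1
  quot := ⟨q, hq⟩
  gen := by
    intro X _ _ _ hX x
    obtain ⟨-, -, T0, T1, f, g, ⟨m, p, s, hps⟩, ⟨m', p', s', hps'⟩, hf, hg, hfg⟩ := hT
    have h1 : EV Λ 1 T1 X := ev_retract s' p' hps' (ev_pow m' hX)
    obtain ⟨l, hl⟩ := ev_ext f g hf hg hfg h1 (LinearMap.toSpanSingleton Λ X x)
    refine ⟨m, l ∘ₗ p, s (f 1), ?_⟩
    have h2 := LinearMap.congr_fun hl 1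
    have h3 := LinearMap.congr_fun hps (f 1)
    simp only [LinearMap.comp_apply, LinearMap.id_apply, LinearMap.toSpanSingleton_apply,
      one_smul] at h2 h3 ⊢
    rw [h3, h2]

end FinalPart


theorem stmt18 (Λ : Type) [Ring Λ] (k : Type) [CommRing k] [IsArtinianRing k] [Algebra k Λ]
    [Module.Finite k Λ]
    (d : ℕ) (hgl : GlobalDimEq Λ d) (hdom : DomdimGE2 Λ)
    (T : Type) [AddCommGroup T] [Module Λ T] [Module.Finite Λ T]
    (hT : IsTilting Λ T) (hTC : MemC Λ T)
    (N : Type) [AddCommGroup N] [Module Λ N] [Module.Finite Λ N]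
    (hN : IsTauOf Λ N T) :
    (∃ m, m < d ∧ GlobalDimLE ((Module.End Λ T)ᵐᵒᵖ) m) ↔
    (∃ m, m < d ∧ pdLE Λ m N) := by
  have hno : IsNoetherianRing Λ := IsNoetherianRing.of_finite k Λ
  have har : IsArtinianRing Λ := IsArtinianRing.of_finite k Λ
  obtain ⟨Q, hfQ, hQ, q, hq⟩ := hTC.1
  have S : Setup Λ k T Q := mkSetup k T inferInstance hT Q hfQ hQ q hq
  obtain ⟨hgl, hmin⟩ := hgl
  have hgl' : ∀ (X : Type) [AddCommGroup X] [Module Λ X], Module.Finite Λ X → PD Λ (d + 1) X :=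
    fun X _ _ hX => pd_of_pdLEcat d (ModuleCat.of Λ X) (hgl (ModuleCat.of Λ X) hX)
  obtain ⟨r, P, A, E, C, f, g, hP, has, ⟨eT⟩, ⟨eN⟩⟩ := hN
  rcases d with _ | _ | e
  · constructor
    · rintro ⟨m, hm, -⟩; omega
    · rintro ⟨m, hm, -⟩; omega
  · have := hmin 0 (gldim_ne_one hdom hgl')
    omega
  let sC : ∀ i, (C i : Type) →ₗ[Λ] T := fun i =>
    eT.symm.toLinearMap ∘ₗ LinearMap.inr Λ _ _ ∘ₗ LinearMap.single Λ (fun i => (C i : Type)) i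
  let pC : ∀ i, T →ₗ[Λ] (C i : Type) := fun i =>
    LinearMap.proj i ∘ₗ LinearMap.snd Λ _ _ ∘ₗ eT.toLinearMap
  have hsC : ∀ i, pC i ∘ₗ sC i = LinearMap.id := by
    intro i
    ext x
    simp [pC, sC]
  let sA : ∀ i, (A i : Type) →ₗ[Λ] N := fun i =>
    eN.symm.toLinearMap ∘ₗ LinearMap.single Λ (fun i => (A i : Type)) i
  let pA : ∀ i, N →ₗ[Λ] (A i : Type) := fun i =>
    LinearMap.proj i ∘ₗ eN.toLinearMap
  have hsA : ∀ i, pA i ∘ₗ sA i = LinearMap.id := by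
    intro i
    ext x
    simp [pA, sA]
  have hCf : ∀ i, Module.Finite Λ (C i) := fun i =>
    Module.Finite.of_surjective (pC i) fun x => ⟨sC i x, LinearMap.congr_fun (hsC i) x⟩
  have hAf : ∀ i, Module.Finite Λ (A i) := fun i =>
    Module.Finite.of_surjective (pA i) fun x => ⟨sA i x, LinearMap.congr_fun (hsA i) x⟩
  constructor
  · rintro ⟨m, hm, hB⟩
    have hBn := endNoeth (Λ := Λ) k T
    have hB' : GlobalDimLE (Module.End Λ T)ᵐᵒᵖ (e + 1) := by
      intro Y hY
      exact pdLEcat_of_pd _ _ hY ((pd_of_pdLEcat _ _ (hB Y hY)).mono (by omega))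
    have hNQ : ∀ a : Q →ₗ[Λ] N, a = 0 := by
      intro a
      ext x
      apply eN.injective
      rw [LinearMap.zero_apply, map_zero]
      funext i
      have := as_hom_zero (f i) (g i) (has i) (hCf i) (hAf i) hQ.2
        (pd_retract (sC i) (pC i) (hsC i) S.pdT) (pA i ∘ₗ a)
      exact LinearMap.congr_fun this x
    exact ⟨e + 1, by omega, pdLEcat_of_pd _ (ModuleCat.of Λ N) (inferInstanceAs (Module.Finite Λ N))
      (S.rev e hB' N inferInstance hNQ)⟩
  · rintro ⟨m, hm, hNm⟩
    have hNpd : PD Λ (e + 2) N := (pd_of_pdLE hNm).mono (by omega)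
    refine ⟨e + 1, by omega, S.fwd e ?_ hgl'⟩
    intro F _ _ hFf hFQ
    refine pd_filt hQ.1 (e + 1) ?_ F (isFiniteLength_iff_isNoetherian_isArtinian.2
      ⟨isNoetherian_of_isNoetherianRing_of_finite Λ F, inferInstance⟩) hFQ
    intro X _ _ hX hXQ
    have hXf : Module.Finite Λ X := inferInstance
    have hTX : ¬ EV Λ 1 T X := by
      intro h
      obtain ⟨n, p, hp⟩ := S.genQ hXf h
      have hp0 : p = 0 := by
        apply LinearMap.pi_ext'
        intro i
        rw [hXQ (p ∘ₗ LinearMap.single Λ (fun _ => (Q : Type)) i), LinearMap.zero_comp]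
      have := IsSimpleModule.nontrivial Λ X
      obtain ⟨x, hx⟩ := exists_ne (0 : X)
      obtain ⟨y, hy⟩ := hp x
      apply hx
      rw [← hy, hp0, LinearMap.zero_apply]
    obtain ⟨i, hi⟩ : ∃ i, ¬ EV Λ 1 (C i) X := by
      by_contra hcon
      push Not at hcon
      apply hTX
      refine ev_retract eT.toLinearMap eT.symm.toLinearMap (by ext; simp) ?_
      exact ev_mid (LinearMap.inl Λ P (∀ i, (C i : Type))) (LinearMap.snd Λ _ _)
        LinearMap.inl_injective LinearMap.snd_surjective (LinearMap.range_inl Λ _ _)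
        ((pd_one_iff.2 hP).ev le_rfl) (ev_pi_aux r C hcon)
    obtain ⟨j, hj⟩ := as_simple (f i) (g i) (has i) (hCf i) hi
    exact pd_left j (LinearMap.range j).mkQ hj (Submodule.mkQ_surjective _) (by simp)
      (pd_retract (sA i) (pA i) (hsA i) hNpd) (hgl' _ inferInstance)
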